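/- The term model of λ_CLC — where for each n, V(n) is the set of values well formed in x₁,…,xₙ modulo provable value equality and C(n) the set of computations well formed in x₁,…,xₙ modulo provable computation equality, with single substitution on V given by value substitution [V₁][n₁ ⊣ [V₂] ⊢ n₂] = [V₁[y := V₂]] and on C by [M₁]{n₁ ⊣ [M₂] ⊢ n₂} = [let y = M₂ in M₁], reindexing given by syntactic renaming, I given by return, abstraction by λ, application by the class of x₁ x₂, and symbol interpretations by their canonical terms [f(x₁,…,xₙ)] and [p(x₁,…,xₙ)] — is a λ_CLC-structure: V is a cartesian operad, C is a symmetric Ren-cartesian preoperad, return is a cartesian preoperad functor whose image is central and forms a cartesian operad, and the weak closure equations hold. -/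

import Mathlib

universe u

/-- A renaming from `m` to `n` is a function `Fin m → Fin n`. -/
abbrev Ren (m n : ℕ) : Type := Fin m → Fin n

/-- The identity renaming. -/
def idRen (n : ℕ) : Ren n n := fun i => i

/-- Block sum of renamings. -/
def bsum {m₁ n₁ m₂ n₂ : ℕ} (r : Ren m₁ n₁) (r' : Ren m₂ n₂) : Ren (m₁ + m₂) (n₁ + n₂) :=
  fun i => Fin.addCases (motive := fun _ => Fin (n₁ + n₂))
    (fun a => Fin.castAdd n₂ (r a)) (fun b => Fin.natAdd n₁ (r' b)) i

/-- The block swap `σ_{m,n} : m+n → n+m`. -/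
def swapRen (m n : ℕ) : Ren (m + n) (n + m) :=
  fun i => Fin.addCases (motive := fun _ => Fin (n + m))
    (fun a => Fin.natAdd n a) (fun b => Fin.castAdd m b) i

/-- The copy renaming `Δ_n : n+n → n`, sending both copies of `i` to `i`. -/
def copyRen (n : ℕ) : Ren (n + n) n :=
  fun i => Fin.addCases (motive := fun _ => Fin n) (fun a => a) (fun b => b) i

/-- The discard renaming `!_n : 0 → n` (the empty function). -/
def discardRen (n : ℕ) : Ren 0 n := fun i => i.elim0

/-- Cast along an equality of arities. -/
def acast {C : ℕ → Type u} {m n : ℕ} (h : m = n) : C m → C n := fun x => h ▸ x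

/-- Cast along equalities of both arities. -/
def hcast {H : ℕ → ℕ → Type u} {a a' b b' : ℕ} (h₁ : a = a') (h₂ : b = b') : H a b → H a' b' :=
  fun f => h₂ ▸ h₁ ▸ f

/-- A preoperad: a family of sets `C n` with an identity `one ∈ C 1` and single
substitution `f{n₁ ⊣ g ⊢ n₂}`, satisfying unit and associativity laws. -/
structure Preoperad where
  C : ℕ → Type
  one : C 1
  subst : ∀ (n₁ n₂ : ℕ) {m : ℕ}, C (n₁ + 1 + n₂) → C m → C (n₁ + m + n₂)
  left_unit : ∀ {m : ℕ} (g : C m), subst 0 0 one g = acast (C := C) (by omega) g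
  right_unit : ∀ {n₁ n₂ : ℕ} (f : C (n₁ + 1 + n₂)), subst n₁ n₂ f one = f
  assoc : ∀ {m₁ m₂ n₁ n₂ k : ℕ} (f : C (m₁ + 1 + m₂)) (g : C (n₁ + 1 + n₂)) (h : C k),
    subst (m₁ + n₁) (n₂ + m₂) (acast (C := C) (by omega) (subst m₁ m₂ f g)) h =
      acast (C := C) (by omega) (subst m₁ m₂ f (subst n₁ n₂ g h))

/-- Two elements `g₁ ∈ C k₁`, `g₂ ∈ C k₂` of a preoperad commute when substituting them
into the two distinguished inputs of any morphism in either order yields the same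
result (in both orientations). -/
def Preoperad.Commute (P : Preoperad) {k₁ k₂ : ℕ} (g₁ : P.C k₁) (g₂ : P.C k₂) : Prop :=
  ∀ (m₁ m m₂ : ℕ) (f : P.C (m₁ + 1 + m + 1 + m₂)),
    (P.subst (m₁ + k₁ + m) m₂
        (acast (C := P.C) (by omega)
          (P.subst m₁ (m + 1 + m₂) (acast (C := P.C) (by omega) f) g₁)) g₂ =
      acast (C := P.C) (by omega)
        (P.subst m₁ (m + k₂ + m₂)
          (acast (C := P.C) (by omega) (P.subst (m₁ + 1 + m) m₂ f g₂)) g₁)) ∧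
    (P.subst (m₁ + k₂ + m) m₂
        (acast (C := P.C) (by omega)
          (P.subst m₁ (m + 1 + m₂) (acast (C := P.C) (by omega) f) g₂)) g₁ =
      acast (C := P.C) (by omega)
        (P.subst m₁ (m + k₁ + m₂)
          (acast (C := P.C) (by omega) (P.subst (m₁ + 1 + m) m₂ f g₁)) g₂))

/-- An element is central if it commutes with every element. -/
def Preoperad.Central (P : Preoperad) {k : ℕ} (g : P.C k) : Prop :=
  ∀ {k' : ℕ} (g' : P.C k'), P.Commute g g'

/-- A `Ren`-cartesian preoperad: a preoperad equipped with reindexing `f[r]` along all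
renamings, functorially, and satisfying the renaming–substitution interchange law. -/
structure RenPreoperad extends Preoperad where
  ren : ∀ {m n : ℕ}, C m → Ren m n → C n
  ren_id : ∀ {m : ℕ} (f : C m), ren f (idRen m) = f
  ren_comp : ∀ {m n k : ℕ} (f : C m) (r₁ : Ren m n) (r₂ : Ren n k),
    ren f (r₂ ∘ r₁) = ren (ren f r₁) r₂
  ren_subst : ∀ {n₁ n₂ k m₁ m₂ m : ℕ} (f : C (n₁ + 1 + n₂)) (g : C k)
      (r₁ : Ren n₁ m₁) (r : Ren k m) (r₂ : Ren n₂ m₂),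
    ren (subst n₁ n₂ f g) (bsum (bsum r₁ r) r₂) =
      subst m₁ m₂ (ren f (bsum (bsum r₁ (idRen 1)) r₂)) (ren g r)

/-- A symmetric `Ren`-cartesian preoperad: transpositions are natural with respect to
single substitution, in both orientations. -/
structure SymRenPreoperad extends RenPreoperad where
  sym_nat₁ : ∀ {m₁ m₂ n : ℕ} (f : C (m₁ + 2 + m₂)) (g : C n),
    subst m₁ (1 + m₂)
        (acast (C := C) (by omega)
          (ren f (bsum (bsum (idRen m₁) (swapRen 1 1)) (idRen m₂)))) g =
      acast (C := C) (by omega)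
        (ren (acast (C := C) (by omega) (subst (m₁ + 1) m₂ f g))
          (bsum (bsum (idRen m₁) (swapRen 1 n)) (idRen m₂)))
  sym_nat₂ : ∀ {m₁ m₂ n : ℕ} (f : C (m₁ + 2 + m₂)) (g : C n),
    subst (m₁ + 1) m₂
        (ren f ((bsum (bsum (idRen m₁) (swapRen 1 1)) (idRen m₂) :
          Ren (m₁ + (1 + 1) + m₂) (m₁ + (1 + 1) + m₂)))) g =
      acast (C := C) (by omega)
        (ren (acast (C := C) (by omega) (subst m₁ (1 + m₂) (acast (C := C) (by omega) f) g))
          (bsum (bsum (idRen m₁) (swapRen n 1)) (idRen m₂)))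

/-- A cartesian operad: a `Ren`-cartesian symmetric preoperad in which every element is
central and in which discard and copy are natural with respect to single substitution. -/
structure CartOperad extends SymRenPreoperad where
  central : ∀ {k : ℕ} (g : C k), toPreoperad.Central g
  discard_nat : ∀ {m₁ m₂ n : ℕ} (f : C (m₁ + 0 + m₂)) (g : C n),
    subst m₁ m₂
        (ren f ((bsum (bsum (idRen m₁) (discardRen 1)) (idRen m₂) :
          Ren (m₁ + 0 + m₂) (m₁ + 1 + m₂)))) g =
      ren f ((bsum (bsum (idRen m₁) (discardRen n)) (idRen m₂) :
        Ren (m₁ + 0 + m₂) (m₁ + n + m₂)))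
  copy_nat : ∀ {m₁ m₂ n : ℕ} (f : C (m₁ + 2 + m₂)) (g : C n),
    subst m₁ m₂
        (ren f ((bsum (bsum (idRen m₁) (copyRen 1)) (idRen m₂) :
          Ren (m₁ + (1 + 1) + m₂) (m₁ + 1 + m₂)))) g =
      ren (acast (C := C) (by omega)
            (subst m₁ (n + m₂) (acast (C := C) (by omega) (subst (m₁ + 1) m₂ f g)) g))
        ((bsum (bsum (idRen m₁) (copyRen n)) (idRen m₂) :
          Ren (m₁ + (n + n) + m₂) (m₁ + n + m₂)))

/-- A cartesian preoperad functor: preserves the identity, single substitution and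
reindexing. -/
structure RenPreoperadHom (P Q : RenPreoperad) where
  map : ∀ {n : ℕ}, P.C n → Q.C n
  map_one : map P.one = Q.one
  map_subst : ∀ {n₁ n₂ m : ℕ} (f : P.C (n₁ + 1 + n₂)) (g : P.C m),
    map (P.subst n₁ n₂ f g) = Q.subst n₁ n₂ (map f) (map g)
  map_ren : ∀ {m n : ℕ} (f : P.C m) (r : Ren m n), map (P.ren f r) = Q.ren (map f) r

/-- Composition of cartesian preoperad functors. -/
def RenPreoperadHom.comp {P Q R : RenPreoperad} (F : RenPreoperadHom P Q)
    (G : RenPreoperadHom Q R) : RenPreoperadHom P R where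
  map f := G.map (F.map f)
  map_one := by show G.map (F.map P.one) = _; rw [F.map_one, G.map_one]
  map_subst f g := by
    show G.map (F.map _) = _
    rw [F.map_subst, G.map_subst]
  map_ren f r := by
    show G.map (F.map _) = _
    rw [F.map_ren, G.map_ren]

/-- A Freyd operad: a cartesian operad `V` of values, a symmetric `Ren`-cartesian
preoperad `C` of computations, and a cartesian preoperad functor `I : V → C` whose image
consists of central elements (and hence forms a cartesian operad). -/
structure FreydOperad where
  V : CartOperad
  C : SymRenPreoperad
  I : RenPreoperadHom V.toRenPreoperad C.toRenPreoperad
  I_central : ∀ {n : ℕ} (v : V.C n), C.toPreoperad.Central (I.map v)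

/-- A Freyd operad functor: a pair of cartesian preoperad functors commuting with the
functors `I`. -/
structure FreydOperadHom (O₁ O₂ : FreydOperad) where
  mapV : RenPreoperadHom O₁.V.toRenPreoperad O₂.V.toRenPreoperad
  mapC : RenPreoperadHom O₁.C.toRenPreoperad O₂.C.toRenPreoperad
  square : ∀ {n : ℕ} (v : O₁.V.C n), mapC.map (O₁.I.map v) = O₂.I.map (mapV.map v)

/-- Composition of Freyd operad functors. -/
def FreydOperadHom.comp {O₁ O₂ O₃ : FreydOperad} (F : FreydOperadHom O₁ O₂)
    (G : FreydOperadHom O₂ O₃) : FreydOperadHom O₁ O₃ where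
  mapV := F.mapV.comp G.mapV
  mapC := F.mapC.comp G.mapC
  square v := by
    show G.mapC.map (F.mapC.map _) = _
    rw [F.square, G.square]; rfl

/-- A weakly closed Freyd operad: abstraction `λₙ : C(n+1) → V(n)` and application
`@ ∈ C 2` satisfying the β-law and compatibility of abstraction with substitution. -/
structure WCFreydOperad extends FreydOperad where
  abs : ∀ {n : ℕ}, C.C (n + 1) → V.C n
  app : C.C 2
  beta : ∀ {n : ℕ} (f : C.C (n + 1)),
    C.subst 0 1 app (I.map (abs f)) = acast (C := C.C) (by omega) f
  abs_subst : ∀ {m₁ m₂ k : ℕ} (f : C.C (m₁ + 1 + (m₂ + 1))) (v : V.C k),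
    abs (acast (C := C.C) (by omega) (C.subst m₁ (m₂ + 1) f (I.map v))) =
      V.subst m₁ m₂ (abs (acast (C := C.C) (by omega) f)) v

/-- A signature: function symbols and procedure symbols, each with an arity. -/
structure Sig where
  Func : Type
  fArity : Func → ℕ
  Proc : Type
  pArity : Proc → ℕ

mutual
/-- Values of λ_CLC, well formed in a context `x₁, …, xₙ` (de Bruijn presentation):
variables, function-symbol applications, and λ-abstractions. -/
inductive DVal (Sg : Sig) : ℕ → Type
  | var {n : ℕ} (i : Fin n) : DVal Sg n
  | func {n : ℕ} (f : Sg.Func) (args : Fin (Sg.fArity f) → DVal Sg n) : DVal Sg n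
  | lam {n : ℕ} (M : DCmp Sg (n + 1)) : DVal Sg n

/-- Computations of λ_CLC, well formed in a context `x₁, …, xₙ`: returned values,
sequencing `let x = M₁ in M₂`, procedure-symbol applications, and applications. -/
inductive DCmp (Sg : Sig) : ℕ → Type
  | ret {n : ℕ} (W : DVal Sg n) : DCmp Sg n
  | letin {n : ℕ} (M₁ : DCmp Sg n) (M₂ : DCmp Sg (n + 1)) : DCmp Sg n
  | proc {n : ℕ} (p : Sg.Proc) (args : Fin (Sg.pArity p) → DVal Sg n) : DCmp Sg n
  | app {n : ℕ} (V₁ V₂ : DVal Sg n) : DCmp Sg n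
end

/-- Lift a renaming under a binder. -/
def liftRen {m n : ℕ} (r : Fin m → Fin n) : Fin (m + 1) → Fin (n + 1) :=
  fun i => Fin.lastCases (Fin.last n) (fun j => (r j).castSucc) i

mutual
/-- Rename the free variables of a value. -/
def renameV {Sg : Sig} : ∀ {m n : ℕ}, DVal Sg m → (Fin m → Fin n) → DVal Sg n
  | _, _, .var i, r => .var (r i)
  | _, _, .func f args, r => .func f (fun i => renameV (args i) r)
  | _, _, .lam M, r => .lam (renameC M (liftRen r))

/-- Rename the free variables of a computation. -/
def renameC {Sg : Sig} : ∀ {m n : ℕ}, DCmp Sg m → (Fin m → Fin n) → DCmp Sg n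
  | _, _, .ret W, r => .ret (renameV W r)
  | _, _, .letin M₁ M₂, r => .letin (renameC M₁ r) (renameC M₂ (liftRen r))
  | _, _, .proc p args, r => .proc p (fun i => renameV (args i) r)
  | _, _, .app V₁ V₂, r => .app (renameV V₁ r) (renameV V₂ r)
end

/-- Lift a simultaneous substitution under a binder. -/
def liftSub {Sg : Sig} {m n : ℕ} (σ : Fin m → DVal Sg n) : Fin (m + 1) → DVal Sg (n + 1) :=
  fun i => Fin.lastCases (.var (Fin.last n)) (fun j => renameV (σ j) Fin.castSucc) i

mutual
/-- Capture-avoiding simultaneous substitution of values for the free variables of a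
value. -/
def substV {Sg : Sig} : ∀ {m n : ℕ}, DVal Sg m → (Fin m → DVal Sg n) → DVal Sg n
  | _, _, .var i, σ => σ i
  | _, _, .func f args, σ => .func f (fun i => substV (args i) σ)
  | _, _, .lam M, σ => .lam (substC M (liftSub σ))

/-- Capture-avoiding simultaneous substitution of values for the free variables of a
computation. -/
def substC {Sg : Sig} : ∀ {m n : ℕ}, DCmp Sg m → (Fin m → DVal Sg n) → DCmp Sg n
  | _, _, .ret W, σ => .ret (substV W σ)
  | _, _, .letin M₁ M₂, σ => .letin (substC M₁ σ) (substC M₂ (liftSub σ))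
  | _, _, .proc p args, σ => .proc p (fun i => substV (args i) σ)
  | _, _, .app V₁ V₂, σ => .app (substV V₁ σ) (substV V₂ σ)
end

/-- Length of the concatenation of a family of contexts with sizes `k 0, …, k (n-1)`. -/
def finSum : ∀ {n : ℕ}, (Fin n → ℕ) → ℕ
  | 0, _ => 0
  | n + 1, k => finSum (fun i => k i.castSucc) + k (Fin.last n)

/-- The embedding of the `i`-th block into the concatenation of blocks of sizes `k`. -/
def blockInj : ∀ {n : ℕ} (k : Fin n → ℕ) (i : Fin n), Fin (k i) → Fin (finSum k)
  | n + 1, k, i =>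
      Fin.lastCases (motive := fun i => Fin (k i) → Fin (finSum k))
        (fun a => Fin.natAdd (finSum fun j => k j.castSucc) a)
        (fun j a => Fin.castAdd (k (Fin.last n)) (blockInj (fun j => k j.castSucc) j a))
        i

/-- Case analysis on the concatenation of blocks of sizes `k`. -/
def finSumCases : ∀ {n : ℕ} (k : Fin n → ℕ) {α : Sort _},
    (∀ i, Fin (k i) → α) → Fin (finSum k) → α
  | 0, _, _, _, j => j.elim0
  | n + 1, k, _, h, j =>
      Fin.addCases (fun a => finSumCases (fun i => k i.castSucc) (fun i => h i.castSucc) a)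
        (fun b => h (Fin.last n) b) j

/-- Iterated (parallel) substitution, with a fixed trailing block of size `t`. -/
def Preoperad.psubAux (P : Preoperad) :
    ∀ {n : ℕ} (k : Fin n → ℕ) (t : ℕ), P.C (n + t) → (∀ i, P.C (k i)) → P.C (finSum k + t)
  | 0, _, _, f, _ => f
  | n + 1, k, t, f, g =>
      acast (C := P.C)
        (by simp only [finSum]; omega)
        (P.psubAux (fun i => k i.castSucc) (k (Fin.last n) + t)
          (acast (C := P.C) (by omega) (P.subst n t f (g (Fin.last n))))
          (fun i => g i.castSucc))

/-- Parallel substitution of the elements `g i ∈ C (k i)` into the `n` inputs of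
`f ∈ C n` (performed sequentially; when the `g i` are central the order is
irrelevant). -/
def Preoperad.psub (P : Preoperad) {n : ℕ} (k : Fin n → ℕ) (f : P.C n)
    (g : ∀ i, P.C (k i)) : P.C (finSum k) :=
  P.psubAux k 0 f g

/-- A λ_CLC-structure over a signature: a weakly closed Freyd operad together with
interpretations of all function and procedure symbols. -/
structure CLCStructure (Sg : Sig) where
  O : WCFreydOperad
  Ff : ∀ f : Sg.Func, O.V.C (Sg.fArity f)
  Pp : ∀ p : Sg.Proc, O.C.C (Sg.pArity p)

mutual
/-- Interpretation of values in a λ_CLC-structure: a variable is the identity reindexed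
along discards, function applications are parallel substitutions into the interpretation
of the symbol (followed by contraction of the shared context), and abstractions are
interpreted by the weak closure. -/
def interpV {Sg : Sig} (S : CLCStructure Sg) : ∀ {n : ℕ}, DVal Sg n → S.O.V.C n
  | n, .var i => S.O.V.ren S.O.V.one (fun _ => i)
  | n, .func f args =>
      S.O.V.ren
        (S.O.V.toPreoperad.psub (fun _ => n) (S.Ff f) (fun i => interpV S (args i)))
        (finSumCases (fun _ => n) (fun _ a => a))
  | _, .lam M => S.O.abs (interpC S M)

/-- Interpretation of computations in a λ_CLC-structure: `return` is interpreted by `I`,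
`let` by single substitution in `C` (followed by contraction of the shared context),
procedure applications like function applications, and application via the weak
closure's application element. -/
def interpC {Sg : Sig} (S : CLCStructure Sg) : ∀ {n : ℕ}, DCmp Sg n → S.O.C.C n
  | _, .ret W => S.O.I.map (interpV S W)
  | n, .letin M₁ M₂ =>
      S.O.C.ren (S.O.C.subst n 0 (interpC S M₂) (interpC S M₁)) (copyRen n)
  | n, .proc p args =>
      S.O.C.ren
        (S.O.C.toPreoperad.psub (fun _ => n) (S.Pp p)
          (fun i => S.O.I.map (interpV S (args i))))
        (finSumCases (fun _ => n) (fun _ a => a))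
  | n, .app V₁ V₂ =>
      S.O.C.ren
        (S.O.C.toPreoperad.psub (fun _ : Fin 2 => n) S.O.app
          (fun i => S.O.I.map (Fin.cases (interpV S V₁) (fun _ => interpV S V₂) i)))
        (finSumCases (fun _ : Fin 2 => n) (fun _ a => a))
end

/-- The single substitution `[x := W]` of a value for the last variable. -/
def sub1 {Sg : Sig} {n : ℕ} (W : DVal Sg n) : Fin (n + 1) → DVal Sg n :=
  fun i => Fin.lastCases W (fun j => .var j) i

/-- Weakening inserting a fresh variable just below the last one. -/
def midWeak (n : ℕ) : Fin (n + 1) → Fin (n + 2) :=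
  fun i => Fin.lastCases (Fin.last (n + 1)) (fun j => j.castSucc.castSucc) i

mutual
/-- The equational theory of λ_CLC on values: the least congruence containing the
axioms (lunit), (runit), (assoc) and (beta). -/
inductive EqV (Sg : Sig) : {n : ℕ} → DVal Sg n → DVal Sg n → Prop
  | refl {n : ℕ} (V : DVal Sg n) : EqV Sg V V
  | symm {n : ℕ} {V₁ V₂ : DVal Sg n} : EqV Sg V₁ V₂ → EqV Sg V₂ V₁
  | trans {n : ℕ} {V₁ V₂ V₃ : DVal Sg n} : EqV Sg V₁ V₂ → EqV Sg V₂ V₃ → EqV Sg V₁ V₃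
  | func {n : ℕ} (f : Sg.Func) {args args' : Fin (Sg.fArity f) → DVal Sg n} :
      (∀ i, EqV Sg (args i) (args' i)) → EqV Sg (.func f args) (.func f args')
  | lam {n : ℕ} {M M' : DCmp Sg (n + 1)} : EqC Sg M M' → EqV Sg (.lam M) (.lam M')

/-- The equational theory of λ_CLC on computations. -/
inductive EqC (Sg : Sig) : {n : ℕ} → DCmp Sg n → DCmp Sg n → Prop
  | refl {n : ℕ} (M : DCmp Sg n) : EqC Sg M M
  | symm {n : ℕ} {M₁ M₂ : DCmp Sg n} : EqC Sg M₁ M₂ → EqC Sg M₂ M₁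
  | trans {n : ℕ} {M₁ M₂ M₃ : DCmp Sg n} : EqC Sg M₁ M₂ → EqC Sg M₂ M₃ → EqC Sg M₁ M₃
  | ret {n : ℕ} {W W' : DVal Sg n} : EqV Sg W W' → EqC Sg (.ret W) (.ret W')
  | letin {n : ℕ} {M₁ M₁' : DCmp Sg n} {M₂ M₂' : DCmp Sg (n + 1)} :
      EqC Sg M₁ M₁' → EqC Sg M₂ M₂' → EqC Sg (.letin M₁ M₂) (.letin M₁' M₂')
  | proc {n : ℕ} (p : Sg.Proc) {args args' : Fin (Sg.pArity p) → DVal Sg n} :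
      (∀ i, EqV Sg (args i) (args' i)) → EqC Sg (.proc p args) (.proc p args')
  | app {n : ℕ} {V₁ V₁' V₂ V₂' : DVal Sg n} :
      EqV Sg V₁ V₁' → EqV Sg V₂ V₂' → EqC Sg (.app V₁ V₂) (.app V₁' V₂')
  /-- (lunit) `let x = return W in M ≡ M[x := W]` -/
  | lunit {n : ℕ} (W : DVal Sg n) (M : DCmp Sg (n + 1)) :
      EqC Sg (.letin (.ret W) M) (substC M (sub1 W))
  /-- (runit) `let x = M in return x ≡ M` -/
  | runit {n : ℕ} (M : DCmp Sg n) :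
      EqC Sg (.letin M (.ret (.var (Fin.last n)))) M
  /-- (assoc) `let y = (let x = M₁ in M₂) in M ≡ let x = M₁ in (let y = M₂ in M)` -/
  | assoc {n : ℕ} (M₁ : DCmp Sg n) (M₂ : DCmp Sg (n + 1)) (M : DCmp Sg (n + 1)) :
      EqC Sg (.letin (.letin M₁ M₂) M)
        (.letin M₁ (.letin M₂ (renameC M (midWeak n))))
  /-- (beta) `(λx.M) W ≡ M[x := W]` -/
  | beta {n : ℕ} (M : DCmp Sg (n + 1)) (W : DVal Sg n) :
      EqC Sg (.app (.lam M) W) (substC M (sub1 W))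
end

/-- Embedding of the left block `n₁` into `n₁ + m + n₂`. -/
def embL (n₁ m n₂ : ℕ) : Fin n₁ → Fin (n₁ + m + n₂) :=
  fun j => Fin.castAdd n₂ (Fin.castAdd m j)

/-- Embedding of the middle block `m` into `n₁ + m + n₂`. -/
def embM (n₁ m n₂ : ℕ) : Fin m → Fin (n₁ + m + n₂) :=
  fun a => Fin.castAdd n₂ (Fin.natAdd n₁ a)

/-- Embedding of the right block `n₂` into `n₁ + m + n₂`. -/
def embR (n₁ m n₂ : ℕ) : Fin n₂ → Fin (n₁ + m + n₂) :=
  fun z => Fin.natAdd (n₁ + m) z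

/-- The simultaneous substitution replacing the distinguished middle variable of
`n₁ + 1 + n₂` by `V₂` (placed in the middle block) and renaming the other variables
accordingly. -/
def midSubst {Sg : Sig} (n₁ n₂ : ℕ) {m : ℕ} (V₂ : DVal Sg m) :
    Fin (n₁ + 1 + n₂) → DVal Sg (n₁ + m + n₂) :=
  fun i =>
    Fin.addCases (motive := fun _ => DVal Sg (n₁ + m + n₂))
      (fun j : Fin (n₁ + 1) =>
        Fin.lastCases (renameV V₂ (embM n₁ m n₂)) (fun j' => .var (embL n₁ m n₂ j')) j)
      (fun z : Fin n₂ => .var (embR n₁ m n₂ z)) i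

/-- Single substitution of a value into the distinguished middle variable of a value. -/
def tsubV {Sg : Sig} (n₁ n₂ : ℕ) {m : ℕ} (V₁ : DVal Sg (n₁ + 1 + n₂)) (V₂ : DVal Sg m) :
    DVal Sg (n₁ + m + n₂) :=
  substV V₁ (midSubst n₁ n₂ V₂)

/-- Renaming sending the distinguished middle variable of `n₁ + 1 + n₂` to the last
variable of `(n₁ + m + n₂) + 1` and the remaining variables to the corresponding
blocks. -/
def midToLast (n₁ n₂ m : ℕ) : Fin (n₁ + 1 + n₂) → Fin (n₁ + m + n₂ + 1) :=
  fun i =>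
    Fin.addCases (motive := fun _ => Fin (n₁ + m + n₂ + 1))
      (fun j : Fin (n₁ + 1) =>
        Fin.lastCases (Fin.last (n₁ + m + n₂)) (fun j' => (embL n₁ m n₂ j').castSucc) j)
      (fun z : Fin n₂ => (embR n₁ m n₂ z).castSucc) i

/-- Single substitution of a computation into the distinguished middle variable of a
computation, given by sequencing: `let y = M₂ in M₁`. -/
def tletC {Sg : Sig} (n₁ n₂ : ℕ) {m : ℕ} (M₁ : DCmp Sg (n₁ + 1 + n₂)) (M₂ : DCmp Sg m) :
    DCmp Sg (n₁ + m + n₂) :=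
  .letin (renameC M₂ (embM n₁ m n₂)) (renameC M₁ (midToLast n₁ n₂ m))

/-- `S` is a term model of λ_CLC: its carriers are equivalence classes of well-formed
terms modulo provable equality, with single substitution given by value substitution
(resp. `let`-sequencing), reindexing by syntactic renaming, `I` by `return`, abstraction
by `λ`, application by the class of `x₁ x₂`, and symbol interpretations by their
canonical terms. -/
def IsTermModel {Sg : Sig} (S : CLCStructure Sg)
    (eV : ∀ n : ℕ, S.O.V.C n ≃ Quot (@EqV Sg n)) (eC : ∀ n : ℕ, S.O.C.C n ≃ Quot (@EqC Sg n)) :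
    Prop :=
  (eV 1 S.O.V.one = Quot.mk _ (.var 0)) ∧
  (eC 1 S.O.C.one = Quot.mk _ (.ret (.var 0))) ∧
  (∀ {n₁ n₂ m : ℕ} (V₁ : DVal Sg (n₁ + 1 + n₂)) (V₂ : DVal Sg m),
    eV _ (S.O.V.subst n₁ n₂ ((eV _).symm (Quot.mk _ V₁)) ((eV _).symm (Quot.mk _ V₂))) =
      Quot.mk _ (tsubV n₁ n₂ V₁ V₂)) ∧
  (∀ {n₁ n₂ m : ℕ} (M₁ : DCmp Sg (n₁ + 1 + n₂)) (M₂ : DCmp Sg m),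
    eC _ (S.O.C.subst n₁ n₂ ((eC _).symm (Quot.mk _ M₁)) ((eC _).symm (Quot.mk _ M₂))) =
      Quot.mk _ (tletC n₁ n₂ M₁ M₂)) ∧
  (∀ {m n : ℕ} (V : DVal Sg m) (r : Ren m n),
    eV _ (S.O.V.ren ((eV _).symm (Quot.mk _ V)) r) = Quot.mk _ (renameV V r)) ∧
  (∀ {m n : ℕ} (M : DCmp Sg m) (r : Ren m n),
    eC _ (S.O.C.ren ((eC _).symm (Quot.mk _ M)) r) = Quot.mk _ (renameC M r)) ∧
  (∀ {n : ℕ} (V : DVal Sg n),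
    eC _ (S.O.I.map ((eV _).symm (Quot.mk _ V))) = Quot.mk _ (.ret V)) ∧
  (∀ {n : ℕ} (M : DCmp Sg (n + 1)),
    eV _ (S.O.abs ((eC _).symm (Quot.mk _ M))) = Quot.mk _ (.lam M)) ∧
  (eC 2 S.O.app = Quot.mk _ (.app (.var 0) (.var 1))) ∧
  (∀ f : Sg.Func, eV _ (S.Ff f) = Quot.mk _ (.func f (fun i => .var i))) ∧
  (∀ p : Sg.Proc, eC _ (S.Pp p) = Quot.mk _ (.proc p (fun i => .var i)))

/-- A morphism of λ_CLC-structures: a pair of cartesian preoperad functors commuting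
with the functors `I`, preserving abstraction and application, and preserving the
interpretations of all function and procedure symbols. -/
structure CLCHom {Sg : Sig} (S₁ S₂ : CLCStructure Sg) where
  mapV : RenPreoperadHom S₁.O.V.toRenPreoperad S₂.O.V.toRenPreoperad
  mapC : RenPreoperadHom S₁.O.C.toRenPreoperad S₂.O.C.toRenPreoperad
  squareI : ∀ {n : ℕ} (v : S₁.O.V.C n), mapC.map (S₁.O.I.map v) = S₂.O.I.map (mapV.map v)
  mapAbs : ∀ {n : ℕ} (f : S₁.O.C.C (n + 1)), mapV.map (S₁.O.abs f) = S₂.O.abs (mapC.map f)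
  mapApp : mapC.map S₁.O.app = S₂.O.app
  mapFf : ∀ f : Sg.Func, mapV.map (S₁.Ff f) = S₂.Ff f
  mapPp : ∀ p : Sg.Proc, mapC.map (S₁.Pp p) = S₂.Pp p

section Syntactic

variable {Sg : Sig}

@[simp] theorem liftRen_castSucc {m n : ℕ} (r : Fin m → Fin n) (i : Fin m) :
    liftRen r i.castSucc = (r i).castSucc := by simp [liftRen]

@[simp] theorem liftRen_last {m n : ℕ} (r : Fin m → Fin n) :
    liftRen r (Fin.last m) = Fin.last n := by simp [liftRen]

@[simp] theorem liftSub_castSucc {m n : ℕ} (σ : Fin m → DVal Sg n) (i : Fin m) :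
    liftSub σ i.castSucc = renameV (σ i) Fin.castSucc := by simp [liftSub]

@[simp] theorem liftSub_last {m n : ℕ} (σ : Fin m → DVal Sg n) :
    liftSub σ (Fin.last m) = .var (Fin.last n) := by simp [liftSub]

@[simp] theorem sub1_castSucc {n : ℕ} (W : DVal Sg n) (i : Fin n) :
    sub1 W i.castSucc = .var i := by simp [sub1]

@[simp] theorem sub1_last {n : ℕ} (W : DVal Sg n) : sub1 W (Fin.last n) = W := by simp [sub1]

@[simp] theorem midWeak_castSucc {n : ℕ} (i : Fin n) :
    midWeak n i.castSucc = i.castSucc.castSucc := by simp [midWeak]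

@[simp] theorem midWeak_last {n : ℕ} : midWeak n (Fin.last n) = Fin.last (n + 1) := by
  simp [midWeak]

theorem liftRen_comp {m n k : ℕ} (r : Fin m → Fin n) (s : Fin n → Fin k) :
    (fun i => liftRen s (liftRen r i)) = liftRen (fun i => s (r i)) := by
  funext i
  induction i using Fin.lastCases <;> simp

theorem liftSub_liftRen {m n k : ℕ} (r : Fin m → Fin n) (σ : Fin n → DVal Sg k) :
    (fun i => liftSub σ (liftRen r i)) = liftSub (fun i => σ (r i)) := by
  funext i
  induction i using Fin.lastCases <;> simp

theorem liftSub_var {m n : ℕ} (r : Fin m → Fin n) :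
    liftSub (fun i => (.var (r i) : DVal Sg n)) = fun i => .var (liftRen r i) := by
  funext i
  induction i using Fin.lastCases <;> simp [renameV]

mutual
theorem renameV_renameV : ∀ {m n k : ℕ} (t : DVal Sg m) (r : Fin m → Fin n) (s : Fin n → Fin k),
    renameV (renameV t r) s = renameV t (fun i => s (r i))
  | _, _, _, .var i, r, s => by simp [renameV]
  | _, _, _, .func f args, r, s => by
      simp only [renameV]
      congr 1
      funext i
      exact renameV_renameV (args i) r s
  | _, _, _, .lam M, r, s => by
      simp only [renameV, renameC_renameC M, liftRen_comp]

theorem renameC_renameC : ∀ {m n k : ℕ} (t : DCmp Sg m) (r : Fin m → Fin n) (s : Fin n → Fin k),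
    renameC (renameC t r) s = renameC t (fun i => s (r i))
  | _, _, _, .ret W, r, s => by simp only [renameC, renameV_renameV W]
  | _, _, _, .letin M N, r, s => by
      simp only [renameC, renameC_renameC M, renameC_renameC N, liftRen_comp]
  | _, _, _, .proc p args, r, s => by
      simp only [renameC]
      congr 1
      funext i
      exact renameV_renameV (args i) r s
  | _, _, _, .app V W, r, s => by
      simp only [renameC, renameV_renameV V, renameV_renameV W]
end

mutual
theorem substV_renameV : ∀ {m n k : ℕ} (t : DVal Sg m) (r : Fin m → Fin n)
    (σ : Fin n → DVal Sg k), substV (renameV t r) σ = substV t (fun i => σ (r i))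
  | _, _, _, .var i, r, s => by simp [renameV, substV]
  | _, _, _, .func f args, r, s => by
      simp only [renameV, substV]
      congr 1
      funext i
      exact substV_renameV (args i) r s
  | _, _, _, .lam M, r, s => by
      simp only [renameV, substV, substC_renameC M, liftSub_liftRen]

theorem substC_renameC : ∀ {m n k : ℕ} (t : DCmp Sg m) (r : Fin m → Fin n)
    (σ : Fin n → DVal Sg k), substC (renameC t r) σ = substC t (fun i => σ (r i))
  | _, _, _, .ret W, r, s => by simp only [renameC, substC, substV_renameV W]
  | _, _, _, .letin M N, r, s => by
      simp only [renameC, substC, substC_renameC M, substC_renameC N, liftSub_liftRen]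
  | _, _, _, .proc p args, r, s => by
      simp only [renameC, substC]
      congr 1
      funext i
      exact substV_renameV (args i) r s
  | _, _, _, .app V W, r, s => by
      simp only [renameC, substC, substV_renameV V, substV_renameV W]
end

theorem liftRen_liftSub {m n k : ℕ} (σ : Fin m → DVal Sg n) (r : Fin n → Fin k) :
    (fun i => renameV (liftSub σ i) (liftRen r)) = liftSub (fun i => renameV (σ i) r) := by
  funext i
  induction i using Fin.lastCases <;> simp [renameV, renameV_renameV]

mutual
theorem renameV_substV : ∀ {m n k : ℕ} (t : DVal Sg m) (σ : Fin m → DVal Sg n)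
    (r : Fin n → Fin k), renameV (substV t σ) r = substV t (fun i => renameV (σ i) r)
  | _, _, _, .var i, r, s => by simp [substV]
  | _, _, _, .func f args, r, s => by
      simp only [renameV, substV]
      congr 1
      funext i
      exact renameV_substV (args i) r s
  | _, _, _, .lam M, r, s => by
      simp only [renameV, substV, renameC_substC M, liftRen_liftSub]

theorem renameC_substC : ∀ {m n k : ℕ} (t : DCmp Sg m) (σ : Fin m → DVal Sg n)
    (r : Fin n → Fin k), renameC (substC t σ) r = substC t (fun i => renameV (σ i) r)
  | _, _, _, .ret W, r, s => by simp only [renameC, substC, renameV_substV W]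
  | _, _, _, .letin M N, r, s => by
      simp only [renameC, substC, renameC_substC M, renameC_substC N, liftRen_liftSub]
  | _, _, _, .proc p args, r, s => by
      simp only [renameC, substC]
      congr 1
      funext i
      exact renameV_substV (args i) r s
  | _, _, _, .app V W, r, s => by
      simp only [renameC, substC, renameV_substV V, renameV_substV W]
end

theorem liftSub_liftSub {m n k : ℕ} (σ : Fin m → DVal Sg n) (τ : Fin n → DVal Sg k) :
    (fun i => substV (liftSub σ i) (liftSub τ)) = liftSub (fun i => substV (σ i) τ) := by
  funext i
  induction i using Fin.lastCases <;> simp [substV, substV_renameV, renameV_substV]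

mutual
theorem substV_substV : ∀ {m n k : ℕ} (t : DVal Sg m) (σ : Fin m → DVal Sg n)
    (τ : Fin n → DVal Sg k), substV (substV t σ) τ = substV t (fun i => substV (σ i) τ)
  | _, _, _, .var i, r, s => by simp [substV]
  | _, _, _, .func f args, r, s => by
      simp only [substV]
      congr 1
      funext i
      exact substV_substV (args i) r s
  | _, _, _, .lam M, r, s => by
      simp only [substV, substC_substC M, liftSub_liftSub]

theorem substC_substC : ∀ {m n k : ℕ} (t : DCmp Sg m) (σ : Fin m → DVal Sg n)
    (τ : Fin n → DVal Sg k), substC (substC t σ) τ = substC t (fun i => substV (σ i) τ)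
  | _, _, _, .ret W, r, s => by simp only [substC, substV_substV W]
  | _, _, _, .letin M N, r, s => by
      simp only [substC, substC_substC M, substC_substC N, liftSub_liftSub]
  | _, _, _, .proc p args, r, s => by
      simp only [substC]
      congr 1
      funext i
      exact substV_substV (args i) r s
  | _, _, _, .app V W, r, s => by
      simp only [substC, substV_substV V, substV_substV W]
end

mutual
theorem renameV_eq_substV : ∀ {m n : ℕ} (t : DVal Sg m) (r : Fin m → Fin n),
    renameV t r = substV t (fun i => .var (r i))
  | _, _, .var i, r => by simp [renameV, substV]
  | _, _, .func f args, r => by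
      simp only [renameV, substV]
      congr 1
      funext i
      exact renameV_eq_substV (args i) r
  | _, _, .lam M, r => by
      simp only [renameV, substV, renameC_eq_substC M, liftSub_var]

theorem renameC_eq_substC : ∀ {m n : ℕ} (t : DCmp Sg m) (r : Fin m → Fin n),
    renameC t r = substC t (fun i => .var (r i))
  | _, _, .ret W, r => by simp only [renameC, substC, renameV_eq_substV W]
  | _, _, .letin M N, r => by
      simp only [renameC, substC, renameC_eq_substC M, renameC_eq_substC N, liftSub_var]
  | _, _, .proc p args, r => by
      simp only [renameC, substC]
      congr 1
      funext i
      exact renameV_eq_substV (args i) r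
  | _, _, .app V W, r => by
      simp only [renameC, substC, renameV_eq_substV V, renameV_eq_substV W]
end

theorem liftRen_id {n : ℕ} : liftRen (fun i : Fin n => i) = fun i => i := by
  funext i
  induction i using Fin.lastCases <;> simp

mutual
theorem renameV_id : ∀ {n : ℕ} (t : DVal Sg n), renameV t (fun i => i) = t
  | _, .var i => by simp [renameV]
  | _, .func f args => by
      simp only [renameV]
      congr 1
      funext i
      exact renameV_id (args i)
  | _, .lam M => by simp only [renameV, liftRen_id, renameC_id M]

theorem renameC_id : ∀ {n : ℕ} (t : DCmp Sg n), renameC t (fun i => i) = t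
  | _, .ret W => by simp only [renameC, renameV_id W]
  | _, .letin M N => by simp only [renameC, liftRen_id, renameC_id M, renameC_id N]
  | _, .proc p args => by
      simp only [renameC]
      congr 1
      funext i
      exact renameV_id (args i)
  | _, .app V W => by simp only [renameC, renameV_id V, renameV_id W]
end

theorem substV_var {n : ℕ} (t : DVal Sg n) : substV t (fun i => .var i) = t := by
  rw [← renameV_eq_substV t (fun i => i), renameV_id]

theorem substC_var {n : ℕ} (t : DCmp Sg n) : substC t (fun i => .var i) = t := by
  rw [← renameC_eq_substC t (fun i => i), renameC_id]

theorem substC_sub1_substC {m n : ℕ} (M : DCmp Sg (m + 1)) (W : DVal Sg m)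
    (σ : Fin m → DVal Sg n) :
    substC (substC M (liftSub σ)) (sub1 (substV W σ)) = substC (substC M (sub1 W)) σ := by
  simp only [substC_substC]
  congr 1
  funext i
  induction i using Fin.lastCases with
  | last => simp [substV]
  | cast i => simp [substV, substV_renameV, substV_var]

theorem substC_midWeak {m n : ℕ} (M : DCmp Sg (m + 1)) (σ : Fin m → DVal Sg n) :
    substC (renameC M (midWeak m)) (liftSub (liftSub σ)) =
      renameC (substC M (liftSub σ)) (midWeak n) := by
  simp only [substC_renameC, renameC_substC]
  congr 1
  funext i
  induction i using Fin.lastCases <;> simp [renameV, renameV_renameV]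

mutual
theorem EqV.substV : ∀ {m n : ℕ} {t t' : DVal Sg m} (_ : EqV Sg t t') (σ : Fin m → DVal Sg n),
    EqV Sg (substV t σ) (substV t' σ)
  | _, _, _, _, .refl _, σ => .refl _
  | _, _, _, _, .symm h, σ => .symm (h.substV σ)
  | _, _, _, _, .trans h h', σ => .trans (h.substV σ) (h'.substV σ)
  | _, _, _, _, .func f h, σ => by
      simp only [_root_.substV]
      exact .func f fun i => (h i).substV σ
  | _, _, _, _, .lam h, σ => by
      simp only [_root_.substV]
      exact .lam (h.substC (liftSub σ))

theorem EqC.substC : ∀ {m n : ℕ} {t t' : DCmp Sg m} (_ : EqC Sg t t') (σ : Fin m → DVal Sg n),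
    EqC Sg (substC t σ) (substC t' σ)
  | _, _, _, _, .refl _, σ => .refl _
  | _, _, _, _, .symm h, σ => .symm (h.substC σ)
  | _, _, _, _, .trans h h', σ => .trans (h.substC σ) (h'.substC σ)
  | _, _, _, _, .ret h, σ => by
      simp only [_root_.substC]
      exact .ret (h.substV σ)
  | _, _, _, _, .letin h h', σ => by
      simp only [_root_.substC]
      exact .letin (h.substC σ) (h'.substC (liftSub σ))
  | _, _, _, _, .proc p h, σ => by
      simp only [_root_.substC]
      exact .proc p fun i => (h i).substV σ
  | _, _, _, _, .app h h', σ => by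
      simp only [_root_.substC]
      exact .app (h.substV σ) (h'.substV σ)
  | _, _, _, _, .lunit W M, σ => by
      simp only [_root_.substC, ← substC_sub1_substC]
      exact .lunit _ _
  | _, _, _, _, .runit M, σ => by
      simp only [_root_.substC, _root_.substV, liftSub_last]
      exact .runit _
  | _, _, _, _, .assoc M₁ M₂ M, σ => by
      simp only [_root_.substC, substC_midWeak]
      exact .assoc _ _ _
  | _, _, _, _, .beta M W, σ => by
      simp only [_root_.substC, _root_.substV, ← substC_sub1_substC]
      exact .beta _ _
end

theorem EqV.renameV {m n : ℕ} {t t' : DVal Sg m} (h : EqV Sg t t') (r : Fin m → Fin n) :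
    EqV Sg (renameV t r) (renameV t' r) := by
  simpa only [renameV_eq_substV] using h.substV _

theorem EqC.renameC {m n : ℕ} {t t' : DCmp Sg m} (h : EqC Sg t t') (r : Fin m → Fin n) :
    EqC Sg (renameC t r) (renameC t' r) := by
  simpa only [renameC_eq_substC] using h.substC _

theorem EqV.liftSub {m n : ℕ} {σ τ : Fin m → DVal Sg n} (h : ∀ i, EqV Sg (σ i) (τ i))
    (i : Fin (m + 1)) : EqV Sg (liftSub σ i) (liftSub τ i) := by
  induction i using Fin.lastCases with
  | last => simpa using EqV.refl _
  | cast i => simpa using (h i).renameV _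

mutual
theorem EqV.substV_congr : ∀ {m n : ℕ} (t : DVal Sg m) {σ τ : Fin m → DVal Sg n}
    (_ : ∀ i, EqV Sg (σ i) (τ i)), EqV Sg (_root_.substV t σ) (_root_.substV t τ)
  | _, _, .var i, _, _, h => by simpa only [_root_.substV] using h i
  | _, _, .func f args, _, _, h => by
      simp only [_root_.substV]
      exact .func f fun i => EqV.substV_congr (args i) h
  | _, _, .lam M, _, _, h => by
      simp only [_root_.substV]
      exact .lam (EqC.substC_congr M (EqV.liftSub h))

theorem EqC.substC_congr : ∀ {m n : ℕ} (t : DCmp Sg m) {σ τ : Fin m → DVal Sg n}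
    (_ : ∀ i, EqV Sg (σ i) (τ i)), EqC Sg (_root_.substC t σ) (_root_.substC t τ)
  | _, _, .ret W, _, _, h => by
      simp only [_root_.substC]
      exact .ret (EqV.substV_congr W h)
  | _, _, .letin M N, _, _, h => by
      simp only [_root_.substC]
      exact .letin (EqC.substC_congr M h) (EqC.substC_congr N (EqV.liftSub h))
  | _, _, .proc p args, _, _, h => by
      simp only [_root_.substC]
      exact .proc p fun i => EqV.substV_congr (args i) h
  | _, _, .app V W, _, _, h => by
      simp only [_root_.substC]
      exact .app (EqV.substV_congr V h) (EqV.substV_congr W h)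
end

end Syntactic

section Renamings

@[simp] theorem val_idRen {n : ℕ} (i : Fin n) : (idRen n i).val = i.val := by
  simp [idRen]

/-- `Fin.val_cast` in a form that `simp` does not use up to definitional unfolding, so that
decidability instances are rewritten along. -/
theorem val_finCast {m n : ℕ} (h : m = n) (i : Fin m) : (Fin.cast h i).val = i.val := by
  simp

theorem val_bsum {m₁ n₁ m₂ n₂ : ℕ} (r : Ren m₁ n₁) (r' : Ren m₂ n₂) (i : Fin (m₁ + m₂)) :
    (bsum r r' i).val =
      if h : i.val < m₁ then (r ⟨i, h⟩).val else n₁ + (r' ⟨i - m₁, by omega⟩).val := by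
  induction i using Fin.addCases <;> simp [bsum]

theorem val_swapRen {m n : ℕ} (i : Fin (m + n)) :
    (swapRen m n i).val = if i.val < m then n + i.val else i.val - m := by
  induction i using Fin.addCases <;> simp [swapRen]

theorem val_copyRen {n : ℕ} (i : Fin (n + n)) :
    (copyRen n i).val = if i.val < n then i.val else i.val - n := by
  induction i using Fin.addCases with
  | left i => simp [copyRen]
  | right i => simp only [copyRen, Fin.addCases_right, Fin.val_natAdd]; simp

theorem val_liftRen {m n : ℕ} (r : Fin m → Fin n) (i : Fin (m + 1)) :
    (liftRen r i).val = if h : i.val < m then (r ⟨i, h⟩).val else n := by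
  induction i using Fin.lastCases <;> simp

theorem val_midWeak {n : ℕ} (i : Fin (n + 1)) :
    (midWeak n i).val = if i.val < n then i.val else n + 1 := by
  induction i using Fin.lastCases <;> simp

@[simp] theorem val_embM {n₁ m n₂ : ℕ} (i : Fin m) : (embM n₁ m n₂ i).val = n₁ + i.val := by
  simp [embM]

theorem val_midToLast {n₁ n₂ m : ℕ} (i : Fin (n₁ + 1 + n₂)) :
    (midToLast n₁ n₂ m i).val =
      if i.val < n₁ then i.val else if i.val = n₁ then n₁ + m + n₂ else i.val - 1 + m := by
  induction i using Fin.addCases with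
  | left i =>
    induction i using Fin.lastCases with
    | last => simp [midToLast]
    | cast i =>
      have := i.2
      simp [midToLast, embL]
  | right i =>
    simp only [midToLast, embR, Fin.addCases_right, Fin.val_castSucc, Fin.val_natAdd]
    split_ifs <;> omega

/-- The renaming exchanging the last two variables. -/
def swapLast (n : ℕ) : Fin (n + 2) → Fin (n + 2) :=
  fun i => Fin.lastCases (Fin.last n).castSucc
    (fun j => Fin.lastCases (Fin.last (n + 1)) (fun k => k.castSucc.castSucc) j) i

theorem val_swapLast {n : ℕ} (i : Fin (n + 2)) :
    (swapLast n i).val = if i.val < n then i.val else if i.val = n then n + 1 else n := by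
  induction i using Fin.lastCases with
  | last => simp [swapLast]
  | cast i => induction i using Fin.lastCases <;> simp [swapLast]

end Renamings

section Substitutions

variable {Sg : Sig}

theorem renameV_congr {m n : ℕ} (t : DVal Sg m) {r s : Fin m → Fin n}
    (h : ∀ i, (r i).val = (s i).val) : renameV t r = renameV t s :=
  congrArg _ (funext fun i => Fin.ext (h i))

theorem renameC_congr {m n : ℕ} (t : DCmp Sg m) {r s : Fin m → Fin n}
    (h : ∀ i, (r i).val = (s i).val) : renameC t r = renameC t s :=
  congrArg _ (funext fun i => Fin.ext (h i))

theorem var_congr {n : ℕ} {i j : Fin n} (h : i.val = j.val) : (.var i : DVal Sg n) = .var j :=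
  congrArg _ (Fin.ext h)

theorem sub1_apply {n : ℕ} (W : DVal Sg n) (i : Fin (n + 1)) :
    sub1 W i = if h : i.val < n then .var ⟨i, h⟩ else W := by
  induction i using Fin.lastCases <;> simp

theorem liftSub_apply {m n : ℕ} (σ : Fin m → DVal Sg n) (i : Fin (m + 1)) :
    liftSub σ i =
      if h : i.val < m then renameV (σ ⟨i, h⟩) Fin.castSucc else .var (Fin.last n) := by
  induction i using Fin.lastCases <;> simp

theorem midSubst_apply {n₁ n₂ m : ℕ} (V : DVal Sg m) (i : Fin (n₁ + 1 + n₂)) :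
    midSubst n₁ n₂ V i =
      if h₁ : i.val < n₁ then .var ⟨i.val, by omega⟩
      else if h₂ : i.val = n₁ then renameV V (embM n₁ m n₂)
      else .var ⟨i.val - 1 + m, by omega⟩ := by
  induction i using Fin.addCases with
  | left i =>
    induction i using Fin.lastCases with
    | last => simp [midSubst]
    | cast i => simp [midSubst, embL]; rfl
  | right i =>
    have h₁ : ¬ n₁ + 1 + i.val < n₁ := by omega
    have h₂ : n₁ + 1 + i.val ≠ n₁ := by omega
    simp only [midSubst, embR, Fin.addCases_right, Fin.val_natAdd, h₁, h₂, dite_false]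
    exact var_congr (by simp; omega)

theorem renameV_midSubst {n₁ n₂ m k : ℕ} (V : DVal Sg m) (i : Fin (n₁ + 1 + n₂))
    (r : Fin (n₁ + m + n₂) → Fin k) :
    renameV (midSubst n₁ n₂ V i) r =
      if h₁ : i.val < n₁ then .var (r ⟨i.val, by omega⟩)
      else if h₂ : i.val = n₁ then renameV V (fun j => r (embM n₁ m n₂ j))
      else .var (r ⟨i.val - 1 + m, by omega⟩) := by
  rw [midSubst_apply]
  split_ifs <;> simp only [renameV, renameV_renameV]

theorem substV_midSubst {n₁ n₂ m k : ℕ} (V : DVal Sg m) (i : Fin (n₁ + 1 + n₂))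
    (σ : Fin (n₁ + m + n₂) → DVal Sg k) :
    substV (midSubst n₁ n₂ V i) σ =
      if h₁ : i.val < n₁ then σ ⟨i.val, by omega⟩
      else if h₂ : i.val = n₁ then substV V (fun j => σ (embM n₁ m n₂ j))
      else σ ⟨i.val - 1 + m, by omega⟩ := by
  rw [midSubst_apply]
  split_ifs <;> simp only [substV, substV_renameV]

theorem sub1_midToLast {n₁ n₂ m : ℕ} (V : DVal Sg m) (i : Fin (n₁ + 1 + n₂)) :
    sub1 (renameV V (embM n₁ m n₂)) (midToLast n₁ n₂ m i) = midSubst n₁ n₂ V i := by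
  induction i using Fin.addCases with
  | left i => induction i using Fin.lastCases <;> simp [midToLast, midSubst]
  | right i => simp [midToLast, midSubst]

theorem tletC_ret {n₁ n₂ m : ℕ} (M : DCmp Sg (n₁ + 1 + n₂)) (V : DVal Sg m) :
    EqC Sg (tletC n₁ n₂ M (.ret V)) (substC M (midSubst n₁ n₂ V)) := by
  refine (EqC.lunit _ _).trans ?_
  simp only [substC_renameC, sub1_midToLast]
  exact .refl _

/-- Returned values commute with arbitrary computations. -/
theorem EqC.ret_comm {n : ℕ} {V : DVal Sg n} {V' : DVal Sg (n + 1)} {M : DCmp Sg n}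
    {M' : DCmp Sg (n + 1)} {F F' : DCmp Sg (n + 1 + 1)} (hV : V' = _root_.renameV V Fin.castSucc)
    (hM : M' = _root_.renameC M Fin.castSucc) (hF : F' = _root_.renameC F (swapLast n)) :
    EqC Sg (.letin (.ret V) (.letin M' F)) (.letin M (.letin (.ret V') F')) := by
  subst hV hM hF
  refine (EqC.lunit _ _).trans (.trans ?_ (EqC.letin (.refl _) (EqC.lunit _ _).symm))
  simp only [_root_.substC, substC_renameC, sub1_castSucc, substC_var]
  refine EqC.letin (.refl _) ?_
  rw [show (fun i => sub1 (_root_.renameV V Fin.castSucc) (swapLast n i)) =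
    _root_.liftSub (sub1 V) from ?_]
  · exact .refl _
  · funext i
    induction i using Fin.lastCases with
    | last => simp [swapLast]
    | cast i => induction i using Fin.lastCases <;> simp [swapLast, renameV]

end Substitutions

section TermModel

variable {Sg : Sig}

/-- Values modulo provable equality. -/
abbrev QVal (Sg : Sig) (n : ℕ) : Type := Quot (@EqV Sg n)

/-- Computations modulo provable equality. -/
abbrev QCmp (Sg : Sig) (n : ℕ) : Type := Quot (@EqC Sg n)

theorem acast_valMk {m n : ℕ} (h : m = n) (t : DVal Sg m) :
    acast (C := QVal Sg) h (Quot.mk _ t) = Quot.mk _ (renameV t (Fin.cast h)) := by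
  subst h
  exact congrArg (Quot.mk _) (renameV_id t).symm

theorem acast_cmpMk {m n : ℕ} (h : m = n) (t : DCmp Sg m) :
    acast (C := QCmp Sg) h (Quot.mk _ t) = Quot.mk _ (renameC t (Fin.cast h)) := by
  subst h
  exact congrArg (Quot.mk _) (renameC_id t).symm

/-- Renaming of values modulo provable equality. -/
def QVal.ren {m n : ℕ} (t : QVal Sg m) (r : Ren m n) : QVal Sg n :=
  Quot.map (fun t => renameV t r) (fun _ _ h => h.renameV r) t

/-- Renaming of computations modulo provable equality. -/
def QCmp.ren {m n : ℕ} (t : QCmp Sg m) (r : Ren m n) : QCmp Sg n :=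
  Quot.map (fun t => renameC t r) (fun _ _ h => h.renameC r) t

theorem EqV.midSubst {n₁ n₂ m : ℕ} {V V' : DVal Sg m} (h : EqV Sg V V')
    (i : Fin (n₁ + 1 + n₂)) : EqV Sg (midSubst n₁ n₂ V i) (midSubst n₁ n₂ V' i) := by
  simp only [midSubst_apply]
  split_ifs
  · exact .refl _
  · exact h.renameV _
  · exact .refl _

/-- Single substitution of values modulo provable equality. -/
def QVal.sub (n₁ n₂ : ℕ) {m : ℕ} (f : QVal Sg (n₁ + 1 + n₂)) (g : QVal Sg m) :
    QVal Sg (n₁ + m + n₂) :=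
  Quot.map₂ (tsubV n₁ n₂) (fun _ _ _ h => EqV.substV_congr _ h.midSubst)
    (fun _ _ _ h => h.substV _) f g

/-- Sequencing of computations modulo provable equality. -/
def QCmp.sub (n₁ n₂ : ℕ) {m : ℕ} (f : QCmp Sg (n₁ + 1 + n₂)) (g : QCmp Sg m) :
    QCmp Sg (n₁ + m + n₂) :=
  Quot.map₂ (tletC n₁ n₂) (fun _ _ _ h => .letin (h.renameC _) (.refl _))
    (fun _ _ _ h => .letin (.refl _) (h.renameC _)) f g

theorem QVal.ren_mk {m n : ℕ} (t : DVal Sg m) (r : Ren m n) :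
    QVal.ren (Quot.mk _ t) r = Quot.mk _ (renameV t r) := rfl

theorem QCmp.ren_mk {m n : ℕ} (t : DCmp Sg m) (r : Ren m n) :
    QCmp.ren (Quot.mk _ t) r = Quot.mk _ (renameC t r) := rfl

theorem QVal.sub_mk {n₁ n₂ m : ℕ} (f : DVal Sg (n₁ + 1 + n₂)) (g : DVal Sg m) :
    QVal.sub n₁ n₂ (Quot.mk _ f) (Quot.mk _ g) = Quot.mk _ (substV f (midSubst n₁ n₂ g)) := rfl

theorem QCmp.sub_mk {n₁ n₂ m : ℕ} (f : DCmp Sg (n₁ + 1 + n₂)) (g : DCmp Sg m) :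
    QCmp.sub n₁ n₂ (Quot.mk _ f) (Quot.mk _ g) =
      Quot.mk _ (.letin (renameC g (embM n₁ m n₂)) (renameC f (midToLast n₁ n₂ m))) := rfl

theorem quot_substV_congr {m n : ℕ} (t : DVal Sg m) {σ τ : Fin m → DVal Sg n}
    (h : ∀ i, σ i = τ i) :
    (Quot.mk _ (substV t σ) : QVal Sg n) = Quot.mk _ (substV t τ) := by
  rw [funext h]

/-- The preoperad of values modulo provable equality. -/
def valPreoperad (Sg : Sig) : Preoperad where
  C := QVal Sg
  one := Quot.mk _ (.var 0)
  subst := QVal.sub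
  left_unit := by
    rintro m ⟨g⟩
    simp only [acast_valMk]
    exact congrArg _ (renameV_congr _ fun i => by simp)
  right_unit := by
    rintro n₁ n₂ ⟨f⟩
    simp only [QVal.sub_mk]
    conv_rhs => rw [← substV_var f]
    refine quot_substV_congr _ fun i => ?_
    simp only [midSubst_apply]
    split_ifs
    · rfl
    · exact var_congr (by simp; omega)
    · exact var_congr (by simp; omega)
  assoc := by
    rintro m₁ m₂ n₁ n₂ k ⟨f⟩ ⟨g⟩ ⟨h⟩
    simp only [QVal.sub_mk, acast_valMk, substV_renameV, substV_substV, renameV_substV]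
    refine quot_substV_congr _ fun i => ?_
    simp only [midSubst_apply, Fin.val_cast]
    split_ifs
    · simp only [substV, renameV]
      split_ifs <;> first | omega | (refine var_congr ?_; simp <;> omega)
    · simp only [substV_renameV, renameV_substV]
      refine congrArg _ (funext fun j => ?_)
      simp only [midSubst_apply, val_embM]
      split_ifs <;> first | omega | simp only [renameV, renameV_renameV]
      · exact var_congr (by simp)
      · refine renameV_congr _ fun a => ?_
        simp <;> omega
      · refine var_congr ?_
        simp <;> omega
    · simp only [substV, renameV]
      split_ifs <;> first | omega | (refine var_congr ?_; simp <;> omega)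

theorem valPreoperad_commute {k₁ k₂ : ℕ} (g₁ : QVal Sg k₁) (g₂ : QVal Sg k₂) (m₁ m m₂ : ℕ)
    (f : QVal Sg (m₁ + 1 + m + 1 + m₂)) :
    QVal.sub (m₁ + k₁ + m) m₂
        (acast (C := QVal Sg) (by omega)
          (QVal.sub m₁ (m + 1 + m₂) (acast (C := QVal Sg) (by omega) f) g₁)) g₂ =
      acast (C := QVal Sg) (by omega)
        (QVal.sub m₁ (m + k₂ + m₂)
          (acast (C := QVal Sg) (by omega) (QVal.sub (m₁ + 1 + m) m₂ f g₂)) g₁) := by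
  rcases f with ⟨f⟩
  rcases g₁ with ⟨g₁⟩
  rcases g₂ with ⟨g₂⟩
  simp only [QVal.sub_mk, acast_valMk, substV_renameV, substV_substV, renameV_substV]
  refine quot_substV_congr _ fun i => ?_
  simp only [midSubst_apply, Fin.val_cast]
  split_ifs
  all_goals try omega
  all_goals simp only [substV, substV_renameV, val_embM]
  all_goals split_ifs
  all_goals try omega
  all_goals first
  | (refine var_congr ?_; simp <;> omega)
  | (simp only [renameV_eq_substV, substV_substV]
     refine congrArg _ (funext fun j => ?_)
     try simp only [substV]
     split_ifs <;> first | omega | (refine var_congr ?_; simp <;> omega))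

theorem bsum_castAdd {m₁ n₁ m₂ n₂ : ℕ} (r : Ren m₁ n₁) (r' : Ren m₂ n₂) (i : Fin m₁) :
    bsum r r' (Fin.castAdd m₂ i) = Fin.castAdd n₂ (r i) := by simp [bsum]

theorem bsum_natAdd {m₁ n₁ m₂ n₂ : ℕ} (r : Ren m₁ n₁) (r' : Ren m₂ n₂) (i : Fin m₂) :
    bsum r r' (Fin.natAdd m₁ i) = Fin.natAdd n₁ (r' i) := by simp only [bsum, Fin.addCases_right]

theorem midSubst_left {n₁ n₂ m : ℕ} (V : DVal Sg m) (i : Fin n₁) :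
    midSubst n₁ n₂ V (Fin.castAdd n₂ (Fin.castAdd 1 i)) = .var (embL n₁ m n₂ i) := by
  rw [midSubst_apply, dif_pos (by simp)]
  rfl

theorem midSubst_mid {n₁ n₂ m : ℕ} (V : DVal Sg m) (i : Fin 1) :
    midSubst n₁ n₂ V (Fin.castAdd n₂ (Fin.natAdd n₁ i)) = renameV V (embM n₁ m n₂) := by
  rw [midSubst_apply, dif_neg (by simp), dif_pos (by simp)]

theorem midSubst_right {n₁ n₂ m : ℕ} (V : DVal Sg m) (i : Fin n₂) :
    midSubst n₁ n₂ V (Fin.natAdd (n₁ + 1) i) = .var (embR n₁ m n₂ i) := by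
  simp [midSubst]

theorem midToLast_left {n₁ n₂ m : ℕ} (i : Fin n₁) :
    midToLast n₁ n₂ m (Fin.castAdd n₂ (Fin.castAdd 1 i)) = (embL n₁ m n₂ i).castSucc := by
  apply Fin.ext
  simp [val_midToLast, embL]

theorem midToLast_mid {n₁ n₂ m : ℕ} (i : Fin 1) :
    midToLast n₁ n₂ m (Fin.castAdd n₂ (Fin.natAdd n₁ i)) = Fin.last _ := by
  apply Fin.ext
  simp [val_midToLast]

theorem midToLast_right {n₁ n₂ m : ℕ} (i : Fin n₂) :
    midToLast n₁ n₂ m (Fin.natAdd (n₁ + 1) i) = (embR n₁ m n₂ i).castSucc := by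
  simp [midToLast]

theorem bsum_embM {n₁ n₂ k m₁ m₂ m : ℕ} (r₁ : Ren n₁ m₁) (r : Ren k m) (r₂ : Ren n₂ m₂)
    (i : Fin k) : bsum (bsum r₁ r) r₂ (embM n₁ k n₂ i) = embM m₁ m m₂ (r i) := by
  simp only [embM, bsum_castAdd, bsum_natAdd]

theorem midSubst_bsum {n₁ n₂ k m₁ m₂ m : ℕ} (V : DVal Sg k) (r₁ : Ren n₁ m₁) (r : Ren k m)
    (r₂ : Ren n₂ m₂) (i : Fin (n₁ + 1 + n₂)) :
    renameV (midSubst n₁ n₂ V i) (bsum (bsum r₁ r) r₂) =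
      midSubst m₁ m₂ (renameV V r) (bsum (bsum r₁ (idRen 1)) r₂ i) := by
  induction i using Fin.addCases with
  | left i =>
    induction i using Fin.addCases with
    | left i => simp only [midSubst_left, bsum_castAdd, renameV, embL]
    | right i => simp only [midSubst_mid, bsum_castAdd, bsum_natAdd, renameV_renameV, bsum_embM]
  | right i => simp only [midSubst_right, bsum_natAdd, renameV, embR]

theorem midToLast_bsum {n₁ n₂ k m₁ m₂ m : ℕ} (r₁ : Ren n₁ m₁) (r : Ren k m)
    (r₂ : Ren n₂ m₂) (i : Fin (n₁ + 1 + n₂)) :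
    liftRen (bsum (bsum r₁ r) r₂) (midToLast n₁ n₂ k i) =
      midToLast m₁ m₂ m (bsum (bsum r₁ (idRen 1)) r₂ i) := by
  induction i using Fin.addCases with
  | left i =>
    induction i using Fin.addCases with
    | left i => simp only [midToLast_left, bsum_castAdd, liftRen_castSucc, embL]
    | right i => simp only [midToLast_mid, bsum_castAdd, bsum_natAdd, liftRen_last]
  | right i => simp only [midToLast_right, bsum_natAdd, liftRen_castSucc, embR]

/-- The `Ren`-cartesian preoperad of values modulo provable equality. -/
def valRenPreoperad (Sg : Sig) : RenPreoperad where
  toPreoperad := valPreoperad Sg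
  ren := QVal.ren
  ren_id := by
    rintro m ⟨f⟩
    exact congrArg (Quot.mk _) (renameV_id f)
  ren_comp := by
    rintro m n k ⟨f⟩ r₁ r₂
    exact congrArg (Quot.mk _) (renameV_renameV f r₁ r₂).symm
  ren_subst := by
    rintro n₁ n₂ k m₁ m₂ m ⟨f⟩ ⟨g⟩ r₁ r r₂
    refine congrArg (Quot.mk _) ?_
    simp only [tsubV, renameV_substV, substV_renameV, midSubst_bsum]

theorem QVal.sub_swap_left {m₁ m₂ n : ℕ} (f : QVal Sg (m₁ + (1 + 1) + m₂)) (g : QVal Sg n) :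
    QVal.sub m₁ (1 + m₂)
        (acast (C := QVal Sg) (by omega)
          (QVal.ren f (bsum (bsum (idRen m₁) (swapRen 1 1)) (idRen m₂)))) g =
      acast (C := QVal Sg) (by omega)
        (QVal.ren (acast (C := QVal Sg) (by omega) (QVal.sub (m₁ + 1) m₂ f g))
          (bsum (bsum (idRen m₁) (swapRen 1 n)) (idRen m₂))) := by
  rcases f with ⟨f⟩
  rcases g with ⟨g⟩
  rw [QVal.ren_mk, acast_valMk, QVal.sub_mk, QVal.sub_mk, acast_valMk, QVal.ren_mk, acast_valMk]
  simp only [substV_renameV, renameV_substV, renameV_renameV]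
  refine quot_substV_congr _ fun ⟨i, hi⟩ => ?_
  simp only [renameV_midSubst]
  simp only [midSubst_apply, val_finCast, val_bsum, val_swapRen, val_idRen]
  split_ifs
  all_goals try omega
  all_goals try simp (disch := omega) only [dif_pos, dif_neg]
  all_goals first | refine var_congr ?_ | refine renameV_congr _ fun a => ?_
  all_goals simp only [val_finCast, val_embM, val_bsum, val_swapRen, val_idRen]
  all_goals split_ifs
  all_goals omega

theorem QVal.sub_swap_right {m₁ m₂ n : ℕ} (f : QVal Sg (m₁ + (1 + 1) + m₂)) (g : QVal Sg n) :
    QVal.sub (m₁ + 1) m₂ (QVal.ren f ((bsum (bsum (idRen m₁) (swapRen 1 1)) (idRen m₂) :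
        Ren (m₁ + (1 + 1) + m₂) (m₁ + (1 + 1) + m₂)))) g =
      acast (C := QVal Sg) (by omega)
        (QVal.ren (acast (C := QVal Sg) (by omega)
            (QVal.sub m₁ (1 + m₂) (acast (C := QVal Sg) (by omega) f) g))
          (bsum (bsum (idRen m₁) (swapRen n 1)) (idRen m₂))) := by
  rcases f with ⟨f⟩
  rcases g with ⟨g⟩
  rw [QVal.ren_mk, acast_valMk, QVal.sub_mk, QVal.sub_mk, acast_valMk, QVal.ren_mk, acast_valMk]
  simp only [substV_renameV, renameV_substV, renameV_renameV]
  refine quot_substV_congr _ fun ⟨i, hi⟩ => ?_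
  simp only [renameV_midSubst]
  simp only [midSubst_apply, val_finCast, val_bsum, val_swapRen, val_idRen]
  split_ifs
  all_goals try omega
  all_goals try simp (disch := omega) only [dif_neg]
  all_goals first | refine var_congr ?_ | refine renameV_congr _ fun a => ?_
  all_goals simp only [val_finCast, val_embM, val_bsum, val_swapRen, val_idRen]
  all_goals split_ifs
  all_goals omega

theorem QVal.sub_discard {m₁ m₂ n : ℕ} (f : QVal Sg (m₁ + 0 + m₂)) (g : QVal Sg n) :
    QVal.sub m₁ m₂ (QVal.ren f (bsum (bsum (idRen m₁) (discardRen 1)) (idRen m₂))) g =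
      QVal.ren f (bsum (bsum (idRen m₁) (discardRen n)) (idRen m₂)) := by
  rcases f with ⟨f⟩
  rcases g with ⟨g⟩
  rw [QVal.ren_mk, QVal.sub_mk, QVal.ren_mk, substV_renameV, renameV_eq_substV]
  refine quot_substV_congr _ fun i => ?_
  simp only [midSubst_apply, val_bsum, val_idRen]
  split_ifs
  all_goals try omega
  all_goals refine var_congr ?_
  all_goals simp only [val_bsum, val_idRen]
  all_goals split_ifs
  all_goals omega

theorem QVal.sub_copy {m₁ m₂ n : ℕ} (f : QVal Sg (m₁ + (1 + 1) + m₂)) (g : QVal Sg n) :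
    QVal.sub m₁ m₂ (QVal.ren f (bsum (bsum (idRen m₁) (copyRen 1)) (idRen m₂))) g =
      QVal.ren (acast (C := QVal Sg) (by omega)
            (QVal.sub m₁ (n + m₂) (acast (C := QVal Sg) (by omega) (QVal.sub (m₁ + 1) m₂ f g)) g))
        (bsum (bsum (idRen m₁) (copyRen n)) (idRen m₂)) := by
  rcases f with ⟨f⟩
  rcases g with ⟨g⟩
  rw [QVal.ren_mk, QVal.sub_mk, QVal.sub_mk, acast_valMk, QVal.sub_mk, acast_valMk, QVal.ren_mk]
  simp only [substV_renameV, renameV_substV, renameV_renameV, substV_substV]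
  refine quot_substV_congr _ fun ⟨i, hi⟩ => ?_
  simp only [renameV_midSubst, substV_midSubst]
  simp only [midSubst_apply, val_finCast, val_bsum, val_copyRen, val_idRen, val_embM]
  split_ifs
  all_goals try omega
  all_goals try simp (disch := omega) only [dif_pos, dif_neg, ← renameV_eq_substV]
  all_goals first | refine var_congr ?_ | refine renameV_congr _ fun a => ?_
  all_goals simp only [val_finCast, val_embM, val_bsum, val_copyRen, val_idRen]
  all_goals try split_ifs
  all_goals omega

/-- The cartesian operad of values modulo provable equality. -/
def valCartOperad (Sg : Sig) : CartOperad where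
  toRenPreoperad := valRenPreoperad Sg
  sym_nat₁ := QVal.sub_swap_left
  sym_nat₂ := QVal.sub_swap_right
  central g _ g' m₁ m m₂ f :=
    ⟨valPreoperad_commute g g' m₁ m m₂ f, valPreoperad_commute g' g m₁ m m₂ f⟩
  discard_nat := QVal.sub_discard
  copy_nat := QVal.sub_copy

theorem liftRen_finCast {m n : ℕ} (h : m = n) :
    liftRen (Fin.cast h) = Fin.cast (congrArg (· + 1) h) := by
  funext i
  apply Fin.ext
  rw [val_liftRen, val_finCast]
  split_ifs with hi
  · exact val_finCast _ _
  · omega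

theorem QCmp.sub_swap_left {m₁ m₂ n : ℕ} (f : QCmp Sg (m₁ + (1 + 1) + m₂)) (g : QCmp Sg n) :
    QCmp.sub m₁ (1 + m₂)
        (acast (C := QCmp Sg) (by omega)
          (QCmp.ren f (bsum (bsum (idRen m₁) (swapRen 1 1)) (idRen m₂)))) g =
      acast (C := QCmp Sg) (by omega)
        (QCmp.ren (acast (C := QCmp Sg) (by omega) (QCmp.sub (m₁ + 1) m₂ f g))
          (bsum (bsum (idRen m₁) (swapRen 1 n)) (idRen m₂))) := by
  rcases f with ⟨f⟩
  rcases g with ⟨g⟩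
  rw [QCmp.ren_mk, acast_cmpMk, QCmp.sub_mk, QCmp.sub_mk, acast_cmpMk, QCmp.ren_mk, acast_cmpMk]
  simp only [renameC, renameC_renameC]
  congr 2 <;> refine renameC_congr _ fun i => ?_
  · simp only [val_finCast, val_embM, val_bsum, val_swapRen, val_idRen]
    split_ifs <;> omega
  · obtain h | h | h | h :
        i.val < m₁ ∨ i.val = m₁ ∨ i.val = m₁ + 1 ∨ m₁ + 1 < i.val := by omega
    all_goals
      simp (disch := omega) only [val_midToLast, liftRen_finCast, val_liftRen, val_finCast,
        val_bsum, val_swapRen, val_idRen, dif_pos, dif_neg, if_pos, if_neg]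
      try omega

theorem QCmp.sub_swap_right {m₁ m₂ n : ℕ} (f : QCmp Sg (m₁ + (1 + 1) + m₂)) (g : QCmp Sg n) :
    QCmp.sub (m₁ + 1) m₂ (QCmp.ren f ((bsum (bsum (idRen m₁) (swapRen 1 1)) (idRen m₂) :
        Ren (m₁ + (1 + 1) + m₂) (m₁ + (1 + 1) + m₂)))) g =
      acast (C := QCmp Sg) (by omega)
        (QCmp.ren (acast (C := QCmp Sg) (by omega)
            (QCmp.sub m₁ (1 + m₂) (acast (C := QCmp Sg) (by omega) f) g))
          (bsum (bsum (idRen m₁) (swapRen n 1)) (idRen m₂))) := by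
  rcases f with ⟨f⟩
  rcases g with ⟨g⟩
  rw [QCmp.ren_mk, acast_cmpMk, QCmp.sub_mk, QCmp.sub_mk, acast_cmpMk, QCmp.ren_mk, acast_cmpMk]
  simp only [renameC, renameC_renameC]
  congr 2 <;> refine renameC_congr _ fun i => ?_
  · simp only [val_finCast, val_embM, val_bsum, val_swapRen, val_idRen]
    split_ifs <;> omega
  · obtain h | h | h | h :
        i.val < m₁ ∨ i.val = m₁ ∨ i.val = m₁ + 1 ∨ m₁ + 1 < i.val := by omega
    all_goals
      simp (disch := omega) only [val_midToLast, liftRen_finCast, val_liftRen, val_finCast,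
        val_bsum, val_swapRen, val_idRen, dif_pos, dif_neg, if_pos, if_neg]
      try omega

/-- The preoperad of computations modulo provable equality. -/
def cmpPreoperad (Sg : Sig) : Preoperad where
  C := QCmp Sg
  one := Quot.mk _ (.ret (.var 0))
  subst := QCmp.sub
  left_unit := by
    rintro m ⟨g⟩
    rw [QCmp.sub_mk, acast_cmpMk]
    have h : (midToLast 0 0 m 0) = Fin.last _ := Fin.ext (by simp [val_midToLast])
    simp only [renameC, renameV, h]
    exact (Quot.sound (EqC.runit _)).trans <| congrArg _ (renameC_congr _ fun i => by simp)
  right_unit := by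
    rintro n₁ n₂ ⟨f⟩
    refine (Quot.sound (tletC_ret f _)).trans (congrArg _ ?_)
    conv_rhs => rw [← substC_var f]
    refine congrArg _ (funext fun i => ?_)
    simp only [midSubst_apply]
    split_ifs
    · rfl
    · exact var_congr (by simp; omega)
    · exact var_congr (by simp; omega)
  assoc := by
    rintro m₁ m₂ n₁ n₂ k ⟨f⟩ ⟨g⟩ ⟨h⟩
    simp only [QCmp.sub_mk, acast_cmpMk, renameC, renameC_renameC]
    rw [Quot.sound (EqC.assoc _ _ _)]
    simp only [renameC_renameC]
    congr 2
    · refine renameC_congr _ fun i => ?_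
      simp only [val_finCast, val_embM]
      omega
    congr 1 <;> refine renameC_congr _ fun i => ?_
    · simp only [val_finCast, val_embM, val_midToLast, liftRen_finCast, val_liftRen]
      split_ifs <;> omega
    · obtain h | h | h : i.val < m₁ ∨ i.val = m₁ ∨ m₁ < i.val := by omega
      all_goals
        simp (disch := omega) only [val_midToLast, liftRen_finCast, val_liftRen, val_midWeak,
          val_finCast, dif_pos, dif_neg, if_pos, if_neg]
        try omega

/-- The `Ren`-cartesian preoperad of computations modulo provable equality. -/
def cmpRenPreoperad (Sg : Sig) : RenPreoperad where
  toPreoperad := cmpPreoperad Sg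
  ren := QCmp.ren
  ren_id := by
    rintro m ⟨f⟩
    exact congrArg (Quot.mk _) (renameC_id f)
  ren_comp := by
    rintro m n k ⟨f⟩ r₁ r₂
    exact congrArg (Quot.mk _) (renameC_renameC f r₁ r₂).symm
  ren_subst := by
    rintro n₁ n₂ k m₁ m₂ m ⟨f⟩ ⟨g⟩ r₁ r r₂
    refine congrArg (Quot.mk _) ?_
    simp only [tletC, renameC, renameC_renameC, bsum_embM, midToLast_bsum]

/-- The symmetric `Ren`-cartesian preoperad of computations modulo provable equality. -/
def cmpSymRenPreoperad (Sg : Sig) : SymRenPreoperad where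
  toRenPreoperad := cmpRenPreoperad Sg
  sym_nat₁ := QCmp.sub_swap_left
  sym_nat₂ := QCmp.sub_swap_right

/-- Returning a value, modulo provable equality. -/
def QVal.ret {n : ℕ} (V : QVal Sg n) : QCmp Sg n :=
  Quot.map .ret (fun _ _ h => .ret h) V

/-- The cartesian preoperad functor sending a value to the computation returning it. -/
def retHom (Sg : Sig) :
    RenPreoperadHom (valCartOperad Sg).toRenPreoperad (cmpSymRenPreoperad Sg).toRenPreoperad where
  map := QVal.ret
  map_one := rfl
  map_subst := by
    rintro n₁ n₂ m ⟨f⟩ ⟨g⟩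
    exact (Quot.sound (tletC_ret (.ret f) g)).symm
  map_ren := by
    rintro m n ⟨f⟩ r
    rfl

theorem QCmp.ret_commute_left {k₁ k₂ : ℕ} (v : QVal Sg k₁) (g : QCmp Sg k₂) (m₁ m m₂ : ℕ)
    (f : QCmp Sg (m₁ + 1 + m + 1 + m₂)) :
    QCmp.sub (m₁ + k₁ + m) m₂
        (acast (C := QCmp Sg) (by omega)
          (QCmp.sub m₁ (m + 1 + m₂) (acast (C := QCmp Sg) (by omega) f) v.ret)) g =
      acast (C := QCmp Sg) (by omega)
        (QCmp.sub m₁ (m + k₂ + m₂)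
          (acast (C := QCmp Sg) (by omega) (QCmp.sub (m₁ + 1 + m) m₂ f g)) v.ret) := by
  rcases f with ⟨f⟩
  rcases g with ⟨g⟩
  rcases v with ⟨v⟩
  simp only [QVal.ret, Quot.map, QCmp.sub_mk, acast_cmpMk, renameC, renameC_renameC,
    renameV_renameV]
  refine (Quot.sound (EqC.ret_comm ?_ ?_ ?_)).symm
  · rw [renameV_renameV]
    refine renameV_congr _ fun i => ?_
    simp only [val_finCast, val_embM, val_midToLast, Fin.val_castSucc]
    split_ifs <;> omega
  · rw [renameC_renameC]
    refine renameC_congr _ fun i => ?_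
    simp only [val_finCast, val_embM, val_midToLast, liftRen_finCast, Fin.val_castSucc]
    split_ifs <;> omega
  · rw [renameC_renameC]
    refine renameC_congr _ fun i => ?_
    obtain h | h | h | h | h : i.val < m₁ ∨ i.val = m₁ ∨ (m₁ < i.val ∧ i.val < m₁ + 1 + m) ∨
      i.val = m₁ + 1 + m ∨ m₁ + 1 + m < i.val := by omega
    all_goals
      simp (disch := omega) only [val_midToLast, liftRen_finCast, val_liftRen, val_swapLast,
        val_finCast, dif_pos, dif_neg, if_pos, if_neg, if_true]
      try omega

theorem QCmp.ret_commute_right {k₁ k₂ : ℕ} (g : QCmp Sg k₁) (v : QVal Sg k₂) (m₁ m m₂ : ℕ)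
    (f : QCmp Sg (m₁ + 1 + m + 1 + m₂)) :
    QCmp.sub (m₁ + k₁ + m) m₂
        (acast (C := QCmp Sg) (by omega)
          (QCmp.sub m₁ (m + 1 + m₂) (acast (C := QCmp Sg) (by omega) f) g)) v.ret =
      acast (C := QCmp Sg) (by omega)
        (QCmp.sub m₁ (m + k₂ + m₂)
          (acast (C := QCmp Sg) (by omega) (QCmp.sub (m₁ + 1 + m) m₂ f v.ret)) g) := by
  rcases f with ⟨f⟩
  rcases g with ⟨g⟩
  rcases v with ⟨v⟩
  simp only [QVal.ret, Quot.map, QCmp.sub_mk, acast_cmpMk, renameC, renameC_renameC,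
    renameV_renameV]
  refine Quot.sound (EqC.ret_comm ?_ ?_ ?_)
  · rw [renameV_renameV]
    refine renameV_congr _ fun i => ?_
    simp only [val_finCast, val_embM, val_midToLast, liftRen_finCast, Fin.val_castSucc]
    split_ifs <;> omega
  · rw [renameC_renameC]
    refine renameC_congr _ fun i => ?_
    simp only [val_finCast, val_embM, val_midToLast, Fin.val_castSucc]
    split_ifs <;> omega
  · rw [renameC_renameC]
    refine renameC_congr _ fun i => ?_
    obtain h | h | h | h | h : i.val < m₁ ∨ i.val = m₁ ∨ (m₁ < i.val ∧ i.val < m₁ + 1 + m) ∨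
      i.val = m₁ + 1 + m ∨ m₁ + 1 + m < i.val := by omega
    all_goals
      simp (disch := omega) only [val_midToLast, liftRen_finCast, val_liftRen, val_swapLast,
        val_finCast, dif_pos, dif_neg, if_pos, if_neg, if_true]
      try omega

/-- Abstraction of computations modulo provable equality. -/
def QCmp.lam {n : ℕ} (M : QCmp Sg (n + 1)) : QVal Sg n :=
  Quot.map .lam (fun _ _ h => .lam h) M

theorem QCmp.app_lam {n : ℕ} (f : QCmp Sg (n + 1)) :
    QCmp.sub 0 1 (Quot.mk _ (.app (.var 0) (.var 1))) f.lam.ret =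
      acast (C := QCmp Sg) (by omega) f := by
  rcases f with ⟨f⟩
  refine (Quot.sound (tletC_ret (n₁ := 0) (n₂ := 1) (.app (.var 0) (.var 1)) (.lam f))).trans ?_
  rw [acast_cmpMk]
  simp only [substC, substV]
  rw [show midSubst 0 1 (.lam f) (0 : Fin (0 + 1 + 1)) = .lam (renameC f _) from
    midSubst_mid (.lam f) 0]
  refine (Quot.sound (EqC.beta _ _)).trans (congrArg _ ?_)
  rw [substC_renameC, renameC_eq_substC]
  refine congrArg _ (funext fun i => ?_)
  rw [sub1_apply]
  split_ifs with h
  · refine var_congr ?_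
    simp only [val_liftRen] at h ⊢
    split_ifs at h ⊢ with h'
    · simp
    · omega
  · rw [midSubst_apply]
    rw [dif_neg (by simp), dif_neg (by simp)]
    refine var_congr ?_
    simp only [val_liftRen] at h ⊢
    split_ifs at h with h'
    · simp at h
      omega
    · simp
      omega

theorem QCmp.lam_sub {m₁ m₂ k : ℕ} (f : QCmp Sg (m₁ + 1 + (m₂ + 1))) (v : QVal Sg k) :
    QCmp.lam (acast (C := QCmp Sg) (by omega) (QCmp.sub m₁ (m₂ + 1) f v.ret)) =
      QVal.sub m₁ m₂ (QCmp.lam (acast (C := QCmp Sg) (by omega) f)) v := by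
  rcases f with ⟨f⟩
  rcases v with ⟨v⟩
  rw [acast_cmpMk]
  refine (congrArg _ (acast_cmpMk _ _)).trans ?_
  refine (Quot.sound (EqV.lam ((tletC_ret f v).renameC _))).trans (congrArg _ ?_)
  refine congrArg _ ((renameC_substC _ _ _).trans (.trans ?_ (substC_renameC _ _ _).symm))
  refine congrArg _ (funext fun i => ?_)
  rw [liftSub_apply, renameV_midSubst]
  simp only [renameV_midSubst, val_finCast]
  obtain h | h | h | h : i.val < m₁ ∨ i.val = m₁ ∨ (m₁ < i.val ∧ i.val < m₁ + 1 + m₂) ∨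
    i.val = m₁ + 1 + m₂ := by omega
  all_goals simp (disch := omega) only [dif_pos, dif_neg]
  all_goals first | refine var_congr ?_ | refine renameV_congr _ fun a => ?_
  all_goals simp [embM]
  omega

/-- The term model of λ_CLC. -/
def termModel (Sg : Sig) : CLCStructure Sg where
  O :=
    { V := valCartOperad Sg
      C := cmpSymRenPreoperad Sg
      I := retHom Sg
      I_central := fun v _ g m₁ m m₂ f =>
        ⟨QCmp.ret_commute_left v g m₁ m m₂ f, QCmp.ret_commute_right g v m₁ m m₂ f⟩
      abs := QCmp.lam
      app := Quot.mk _ (.app (.var 0) (.var 1))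
      beta := QCmp.app_lam
      abs_subst := QCmp.lam_sub }
  Ff f := Quot.mk _ (.func f .var)
  Pp p := Quot.mk _ (.proc p .var)

theorem isTermModel_termModel (Sg : Sig) :
    IsTermModel (termModel Sg) (fun _ => Equiv.refl _) (fun _ => Equiv.refl _) :=
  ⟨rfl, rfl, fun _ _ => rfl, fun _ _ => rfl, fun _ _ => rfl, fun _ _ => rfl, fun _ => rfl,
    fun _ => rfl, rfl, fun _ => rfl, fun _ => rfl⟩

end TermModel

/-- **term model.** The term model of λ_CLC — values and computations
well formed in `x₁, …, xₙ` modulo provable equality, with single substitution given by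
value substitution and `let`-sequencing, reindexing by syntactic renaming, `I` by
`return`, abstraction by `λ`, application by the class of `x₁ x₂`, and symbol
interpretations by their canonical terms — is a λ_CLC-structure (so its value part is a
cartesian operad, its computation part a symmetric `Ren`-cartesian preoperad, `return` a
cartesian preoperad functor with central image, and the weak closure equations hold). -/
theorem stmt17 (Sg : Sig) :
    ∃ (S : CLCStructure Sg) (eV : ∀ n : ℕ, S.O.V.C n ≃ Quot (@EqV Sg n))
      (eC : ∀ n : ℕ, S.O.C.C n ≃ Quot (@EqC Sg n)), IsTermModel S eV eC :=
  ⟨termModel Sg, fun _ => Equiv.refl _, fun _ => Equiv.refl _, isTermModel_termModel Sg⟩
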